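/- Let V ⊆ ℂ be a nonempty simply connected domain, ρ a holomorphic function on V, and let (z₀, u₀, q₀) ∈ V × ℝ × ℂ. Then there exist holomorphic functions w₁, w₂ on V solving Hill's equation w'' + (ρ/4) w = 0 with Wronskian w₁ w₂' − w₂ w₁' = 1/2, such that the function u = log(|w₁|² + |w₂|²) satisfies u(z₀) = u₀ and ∂_z u(z₀) = q₀. -/

import Mathlib

/-- The Wirtinger derivative `∂_z f = (1/2)(∂_x f - i ∂_y f)`. -/
noncomputable def wirtingerZ (f : ℂ → ℂ) (z : ℂ) : ℂ :=
  (1 / 2) * (fderiv ℝ f z 1 - Complex.I * fderiv ℝ f z Complex.I)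

section Monodromy

open Set Filter Topology TopologicalSpace CategoryTheory Opposite

universe u

variable {X T : Type u} [TopologicalSpace X]

/-- The prelocal predicate of being the restriction of a function `F : X → T` such that `Q F x`
holds at every point `x` of the domain. -/
def restrictionPrelocal (Q : (X → T) → X → Prop) :
    TopCat.PrelocalPredicate (X := TopCat.of X) fun _ ↦ T where
  pred {U} f := ∃ F : X → T, (∀ x : U, Q F x) ∧ ∀ x : U, f x = F x
  res i _ := fun ⟨F, hF, hf⟩ ↦ ⟨F, fun x ↦ hF ⟨x, i.le x.2⟩, fun x ↦ hf ⟨x, i.le x.2⟩⟩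

/-- The section over `U` defined by a function `F` satisfying `Q` on `U`. -/
def restrictionSection (Q : (X → T) → X → Prop) (U : Opens (TopCat.of X)) (F : X → T)
    (hF : ∀ x : U, Q F x) :
    ToType ((TopCat.subpresheafToTypes (restrictionPrelocal Q)).obj (op U)) :=
  ⟨fun x ↦ F x, F, hF, fun _ ↦ rfl⟩

theorem exists_eq_restrictionSection {Q : (X → T) → X → Prop} {U : Opens (TopCat.of X)}
    (s : ToType ((TopCat.subpresheafToTypes (restrictionPrelocal Q)).obj (op U))) :
    ∃ F hF, s = restrictionSection Q U F hF := by
  obtain ⟨f, F, hF, hf⟩ := s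
  exact ⟨F, hF, Subtype.ext (funext hf)⟩

theorem germ_restrictionSection_eq_iff {Q : (X → T) → X → Prop} {U V : Opens (TopCat.of X)}
    {F G : X → T} (hF : ∀ x : U, Q F x) (hG : ∀ x : V, Q G x) {x : X} (hU : x ∈ U) (hV : x ∈ V) :
    (TopCat.subpresheafToTypes (restrictionPrelocal Q)).germ U x hU (restrictionSection Q U F hF) =
      (TopCat.subpresheafToTypes (restrictionPrelocal Q)).germ V x hV
        (restrictionSection Q V G hG) ↔ F =ᶠ[𝓝 x] G := by
  constructor
  · intro h
    obtain ⟨W, hxW, iU, iV, h⟩ := TopCat.Presheaf.germ_eq _ _ _ _ _ _ h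
    filter_upwards [W.isOpen.mem_nhds hxW] with y hy
    exact congr_fun (congr_arg Subtype.val h) ⟨y, hy⟩
  · intro h
    obtain ⟨W, hW, hWo, hxW⟩ := eventually_nhds_iff.1
      (h.and ((U.isOpen.eventually_mem hU).and (V.isOpen.eventually_mem hV)))
    let W' : Opens (TopCat.of X) := ⟨W, hWo⟩
    rw [← TopCat.Presheaf.germ_res_apply _ (homOfLE fun y hy ↦ (hW y hy).2.1 : W' ⟶ U) x hxW,
      ← TopCat.Presheaf.germ_res_apply _ (homOfLE fun y hy ↦ (hW y hy).2.2 : W' ⟶ V) x hxW]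
    congr 1
    exact Subtype.ext (funext fun y ↦ (hW y y.2).1)

/-- **Monodromy theorem**. Let `Q` be a pointwise condition on functions. Suppose that each point of
a simply connected set `V` has an open neighbourhood `U` to which every germ of a solution of `Q` at
a point of `U` extends uniquely. Then every germ of a solution at a point of `V` extends to `V`. -/
theorem exists_extension_of_locally_extendable {V : Set X} [SimplyConnectedSpace V]
    [LocallyPathConnectedSpace V] (Q : (X → T) → X → Prop)
    (hQ : ∀ x ∈ V, ∃ U : Set X, IsOpen U ∧ x ∈ U ∧ ∀ y ∈ U,
      (∀ F : X → T, (∀ᶠ z in 𝓝 y, Q F z) → ∃ G : X → T, (∀ z ∈ U, Q G z) ∧ G =ᶠ[𝓝 y] F) ∧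
      ∀ F G : X → T, (∀ z ∈ U, Q F z) → (∀ z ∈ U, Q G z) → F =ᶠ[𝓝 y] G → EqOn F G U)
    {x₀ : X} (hx₀ : x₀ ∈ V) (F₀ : X → T) (hF₀ : ∀ᶠ z in 𝓝 x₀, Q F₀ z) :
    ∃ F : X → T, (∀ᶠ z in 𝓝[V] x₀, F z = F₀ z) ∧
      ∀ x ∈ V, ∃ G : X → T, (∀ᶠ z in 𝓝 x, Q G z) ∧ ∀ᶠ z in 𝓝[V] x, F z = G z := by
  let P := TopCat.subpresheafToTypes (restrictionPrelocal Q)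
  have hcov : IsCoveringMapOn (TopCat.Presheaf.EtaleSpace.base (F := P)) V := by
    intro x hx
    obtain ⟨U, hUo, hxU, hU⟩ := hQ x hx
    let U' : Opens (TopCat.of X) := ⟨U, hUo⟩
    have hbij : ∀ y (hy : y ∈ U'), Function.Bijective (P.germ U' y hy) := by
      intro y hy
      constructor
      · intro s t hst
        obtain ⟨F, hF, rfl⟩ := exists_eq_restrictionSection s
        obtain ⟨G, hG, rfl⟩ := exists_eq_restrictionSection t
        have h := (germ_restrictionSection_eq_iff hF hG hy hy).1 hst
        have := (hU y hy).2 F G (fun z hz ↦ hF ⟨z, hz⟩) (fun z hz ↦ hG ⟨z, hz⟩) h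
        exact Subtype.ext (funext fun z ↦ this z.2)
      · intro g
        obtain ⟨W, hyW, s, rfl⟩ := P.exists_germ_eq g
        obtain ⟨F, hF, rfl⟩ := exists_eq_restrictionSection s
        obtain ⟨G, hG, hGF⟩ := (hU y hy).1 F <| by
          filter_upwards [W.isOpen.mem_nhds hyW] with z hz using hF ⟨z, hz⟩
        exact ⟨restrictionSection Q U' G fun z ↦ hG z z.2,
          (germ_restrictionSection_eq_iff _ _ hy hyW).2 hGF⟩
    refine IsEvenlyCovered.to_isEvenlyCovered_preimage
      (I := WithDiscreteTopology (ToType (P.stalk x))) ?_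
    use inferInstance
    use U', hxU, U'.isOpen,
      U'.isOpen.preimage (TopCat.Presheaf.EtaleSpace.continuous_base P),
      TopCat.Presheaf.EtaleSpace.homeomorph U' hbij x hxU
    exact fun _ ↦ rfl
  obtain ⟨W₀, hW₀, hW₀o, hxW₀⟩ := eventually_nhds_iff.1 hF₀
  let s₀ := restrictionSection Q ⟨W₀, hW₀o⟩ F₀ fun x ↦ hW₀ x x.2
  obtain ⟨L, ⟨hL₀, hL⟩, -⟩ := hcov.existsUnique_continuousMap_lifts
    (A := V) ⟨Subtype.val, continuous_subtype_val⟩ (a₀ := ⟨x₀, hx₀⟩)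
    (e₀ := ⟨x₀, P.germ ⟨W₀, hW₀o⟩ x₀ hxW₀ s₀⟩) rfl fun a ↦ a.2
  have hbase (x : V) : (L x).base = x := congr_fun hL x
  have hrep (g : P.EtaleSpace) : ∃ F : X → T, ∃ (U : Opens (TopCat.of X)) (hU : g.base ∈ U)
      (hF : ∀ x : U, Q F x), P.germ U g.base hU (restrictionSection Q U F hF) = g.germ := by
    obtain ⟨U, hU, s, hs⟩ := P.exists_germ_eq g.germ
    obtain ⟨F, hF, rfl⟩ := exists_eq_restrictionSection s
    exact ⟨F, U, hU, hF, hs⟩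
  choose R U hU hR hRg using hrep
  classical
  let F : X → T := fun x ↦ if hx : x ∈ V then R (L ⟨x, hx⟩) x else F₀ x
  have key (x : V) {W : Opens (TopCat.of X)} {G : X → T} (hG : ∀ x : W, Q G x)
      (hW : (L x).base ∈ W)
      (h : (L x).germ = P.germ W (L x).base hW (restrictionSection Q W G hG)) :
      ∀ᶠ z in 𝓝[V] x.1, F z = G z := by
    have h1 := (L x).eventually_nhds hW (restrictionSection Q W G hG) h.symm
    have h2 := L.continuous.continuousAt.eventually h1
    rw [nhdsWithin_eq_map_subtype_coe x.2, eventually_map]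
    filter_upwards [h2] with z hz
    obtain ⟨hzW, hz⟩ := hz
    have := ((germ_restrictionSection_eq_iff (hR _) hG (hU _) hzW).1
      ((hRg (L z)).trans hz)).eq_of_nhds
    simpa [F, hbase] using this
  have h₀ : ∀ᶠ z in 𝓝[V] x₀, F z = F₀ z := by
    have (e : P.EtaleSpace) (he : e = ⟨x₀, P.germ ⟨W₀, hW₀o⟩ x₀ hxW₀ s₀⟩) :
        ∃ h : e.base ∈ (⟨W₀, hW₀o⟩ : Opens (TopCat.of X)), e.germ = P.germ _ e.base h s₀ := by
      subst he
      exact ⟨hxW₀, rfl⟩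
    obtain ⟨hW, hg⟩ := this _ hL₀
    exact key ⟨x₀, hx₀⟩ _ hW hg
  refine ⟨F, h₀, fun x hx ↦ ?_⟩
  refine ⟨R (L ⟨x, hx⟩), ?_, key ⟨x, hx⟩ (hR _) (hU _) (hRg _).symm⟩
  have := (U (L ⟨x, hx⟩)).isOpen.mem_nhds (hU (L ⟨x, hx⟩))
  rw [hbase] at this
  filter_upwards [this] with z hz using hR _ ⟨z, hz⟩

end Monodromy

section PowerSeries

open Set Filter Topology Metric

/-- The Taylor coefficients of the solution of `w'' + g w = 0` with `w = α` and `w' = β` at the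
centre, where `γ` is the sequence of Taylor coefficients of `g`. -/
noncomputable def hillCoeff (γ : ℕ → ℂ) (α β : ℂ) : ℕ → ℂ
  | 0 => α
  | 1 => β
  | n + 2 => -(∑ k : Fin (n + 1), γ k * hillCoeff γ α β (n - k)) / ((n + 1) * (n + 2))

theorem hillCoeff_add_two (γ : ℕ → ℂ) (α β : ℂ) (n : ℕ) :
    hillCoeff γ α β (n + 2) =
      -(∑ k ∈ Finset.range (n + 1), γ k * hillCoeff γ α β (n - k)) / ((n + 1) * (n + 2)) := by
  rw [hillCoeff, Finset.sum_range]

theorem norm_hillCoeff_le {γ : ℕ → ℂ} {K : ℝ} (hK : 1 ≤ K) (hγ : ∀ n, ‖γ n‖ ≤ K ^ (n + 2))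
    (α β : ℂ) (n : ℕ) : ‖hillCoeff γ α β n‖ ≤ (‖α‖ + ‖β‖) * K ^ n := by
  have hK0 : 0 ≤ K := by linarith
  induction n using Nat.strong_induction_on with
  | _ n ih =>
    match n with
    | 0 => simp [hillCoeff]
    | 1 =>
      rw [hillCoeff, pow_one]
      nlinarith [norm_nonneg α, norm_nonneg β]
    | n + 2 =>
      have hsum : ‖∑ k ∈ Finset.range (n + 1), γ k * hillCoeff γ α β (n - k)‖ ≤
          (n + 1) * ((‖α‖ + ‖β‖) * K ^ (n + 2)) := by
        refine (norm_sum_le_of_le _ (f := fun k ↦ γ k * hillCoeff γ α β (n - k))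
          (n := fun _ ↦ (‖α‖ + ‖β‖) * K ^ (n + 2)) fun k hk ↦ ?_).trans_eq (by simp)
        have hk' : k ≤ n := Nat.lt_succ_iff.1 (Finset.mem_range.1 hk)
        rw [norm_mul]
        refine (mul_le_mul (hγ k) (ih (n - k) (by omega)) (norm_nonneg _)
          (by positivity)).trans_eq ?_
        rw [mul_left_comm, ← pow_add]
        congr 2
        omega
      have hden : ‖((n : ℂ) + 1) * (n + 2)‖ = ((n : ℝ) + 1) * (n + 2) := by
        exact_mod_cast Complex.norm_natCast ((n + 1) * (n + 2))
      rw [hillCoeff_add_two, norm_div, norm_neg, hden, div_le_iff₀ (by positivity)]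
      refine hsum.trans ?_
      have : 0 ≤ (‖α‖ + ‖β‖) * K ^ (n + 2) := by positivity
      nlinarith [mul_nonneg (Nat.cast_nonneg (α := ℝ) n) this,
        mul_nonneg (mul_nonneg (Nat.cast_nonneg (α := ℝ) n) (Nat.cast_nonneg (α := ℝ) n)) this]

theorem exists_differentiableOn_ball_iteratedDeriv_eq {a : ℕ → ℂ} {A K : ℝ} (hK : 0 < K)
    (ha : ∀ n, ‖a n‖ ≤ A * K ^ n) (c : ℂ) :
    ∃ f : ℂ → ℂ, DifferentiableOn ℂ f (ball c K⁻¹) ∧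
      ∀ n, iteratedDeriv n f c = n.factorial * a n := by
  let p := FormalMultilinearSeries.ofScalars ℂ a
  have hr : ENNReal.ofReal K⁻¹ ≤ p.radius := by
    refine p.le_radius_of_bound A fun n ↦ ?_
    rw [FormalMultilinearSeries.ofScalars_norm, Real.coe_toNNReal _ (by positivity), inv_pow,
      ← div_eq_mul_inv, div_le_iff₀ (by positivity)]
    exact ha n
  have hpos : 0 < ENNReal.ofReal K⁻¹ := by simpa using hK
  have hp := ((p.hasFPowerSeriesOnBall (hpos.trans_le hr)).comp_sub c).mono hpos hr
  rw [zero_add] at hp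
  refine ⟨fun z ↦ p.sum (z - c), ?_, fun n ↦ ?_⟩
  · have := hp.differentiableOn
    rwa [Metric.eball_ofReal] at this
  · rw [iteratedDeriv_eq_iteratedFDeriv, ← hp.factorial_smul 1 n]
    change _ • p.coeff n = _
    simp [p]

theorem exists_hill_solution_ball {g : ℂ → ℂ} {c : ℂ} {s : Set ℂ} (hs : s ∈ 𝓝 c)
    (hg : DifferentiableOn ℂ g s) :
    ∃ r > 0, ball c r ⊆ s ∧ ∀ α β : ℂ, ∃ f : ℂ → ℂ, f c = α ∧ deriv f c = β ∧
      DifferentiableOn ℂ f (ball c r) ∧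
      ∀ z ∈ ball c r, deriv (deriv f) z + g z * f z = 0 := by
  obtain ⟨R, hR, hRs⟩ := nhds_basis_closedBall.mem_iff.1 hs
  have hgR := hg.mono hRs
  obtain ⟨M, hM⟩ := (isCompact_closedBall c R).exists_bound_of_continuousOn hgR.continuousOn
  have hM0 : 0 ≤ M := (norm_nonneg _).trans (hM c (mem_closedBall_self hR.le))
  let K := 1 + M + R⁻¹
  have hK1 : 1 ≤ K := by simp only [K]; linarith [inv_pos.2 hR]
  have hKR : R⁻¹ ≤ K := by simp only [K]; linarith
  have hKM : M ≤ K ^ 2 := by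
    have : M ≤ K := by simp only [K]; linarith [inv_pos.2 hR]
    nlinarith
  have hK0 : 0 < K := by linarith
  have hKle : K⁻¹ ≤ R := inv_le_of_inv_le₀ hR hKR
  have hsub : ball c K⁻¹ ⊆ closedBall c R := (ball_subset_ball hKle).trans ball_subset_closedBall
  have hgK := hgR.mono hsub
  let γ : ℕ → ℂ := fun n ↦ iteratedDeriv n g c / n.factorial
  have hγ (n : ℕ) : ‖γ n‖ ≤ K ^ (n + 2) := by
    have h := Complex.norm_iteratedDeriv_le_of_forall_mem_sphere_norm_le n hR
      (hgR.diffContOnCl_ball Subset.rfl) fun z hz ↦ hM z (sphere_subset_closedBall hz)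
    have hn : (0 : ℝ) < n.factorial := by positivity
    rw [norm_div, Complex.norm_natCast, div_le_iff₀ hn]
    refine h.trans ?_
    rw [mul_div_assoc, mul_comm]
    gcongr
    rw [div_eq_mul_inv, ← inv_pow, add_comm n 2, pow_add]
    gcongr
  refine ⟨K⁻¹, by positivity, hsub.trans hRs, fun α β ↦ ?_⟩
  obtain ⟨f, hf, hfn⟩ :=
    exists_differentiableOn_ball_iteratedDeriv_eq hK0 (norm_hillCoeff_le hK1 hγ α β) c
  refine ⟨f, ?_, ?_, hf, fun z hz ↦ ?_⟩
  · simpa [hillCoeff] using hfn 0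
  · simpa [hillCoeff] using hfn 1
  have hc : ball c K⁻¹ ∈ 𝓝 c := ball_mem_nhds _ (by positivity)
  have hf2 := (hf.deriv isOpen_ball).deriv isOpen_ball
  have hcd {u : ℂ → ℂ} (hu : DifferentiableOn ℂ u (ball c K⁻¹)) (n : ℕ) : ContDiffAt ℂ n u c :=
    (hu.analyticAt hc).contDiffAt
  rw [← Complex.taylorSeries_eq_on_ball' (f := fun z ↦ deriv (deriv f) z + g z * f z) hz
    (hf2.add (hgK.mul hf))]
  refine (tsum_congr fun n ↦ ?_).trans tsum_zero
  have hzero : iteratedDeriv n (fun z ↦ deriv (deriv f) z + g z * f z) c = 0 := by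
    rw [iteratedDeriv_fun_add (hcd hf2 n) (hcd (hgK.fun_mul hf) n),
      iteratedDeriv_fun_mul (hcd hgK n) (hcd hf n), ← iteratedDeriv_succ', ← iteratedDeriv_succ',
      hfn, hillCoeff_add_two]
    have : ∀ k ∈ Finset.range (n + 1), (n.choose k : ℂ) * iteratedDeriv k g c *
        iteratedDeriv (n - k) f c = n.factorial * (γ k * hillCoeff γ α β (n - k)) := by
      intro k hk
      have hk' : k ≤ n := Nat.lt_succ_iff.1 (Finset.mem_range.1 hk)
      have h1 : (n.choose k : ℂ) * k.factorial * (n - k).factorial = n.factorial := by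
        exact_mod_cast Nat.choose_mul_factorial_mul_factorial hk'
      have h2 : (k.factorial : ℂ) ≠ 0 := by exact_mod_cast k.factorial_ne_zero
      rw [hfn, ← h1]
      simp only [γ]
      field_simp
    rw [Finset.sum_congr rfl this, ← Finset.mul_sum, Nat.factorial_succ, Nat.factorial_succ]
    have h1 : (n : ℂ) + 1 ≠ 0 := by exact_mod_cast n.succ_ne_zero
    have h2 : (n : ℂ) + 2 ≠ 0 := by exact_mod_cast (n + 1).succ_ne_zero
    push_cast
    field_simp
    ring
  simp [hzero]

end PowerSeries

/-- `w` solves `w'' + g w = 0` at the point `z`. -/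
def IsHillSolutionAt (g w : ℂ → ℂ) (z : ℂ) : Prop :=
  DifferentiableAt ℂ w z ∧ deriv (deriv w) z + g z * w z = 0

/-- The Wronskian `u v' - v u'` of `u` and `v`. -/
noncomputable def hillWronskian (u v : ℂ → ℂ) (z : ℂ) : ℂ :=
  u z * deriv v z - v z * deriv u z

section Hill

open Set Filter Topology Metric

variable {g u v w : ℂ → ℂ} {s : Set ℂ} {z : ℂ}

theorem differentiableOn_of_isHillSolutionAt (hw : ∀ z ∈ s, IsHillSolutionAt g w z) :
    DifferentiableOn ℂ w s :=
  fun z hz ↦ (hw z hz).1.differentiableWithinAt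

theorem IsHillSolutionAt.congr (hu : IsHillSolutionAt g u z) (h : v =ᶠ[𝓝 z] u) :
    IsHillSolutionAt g v z := by
  refine ⟨hu.1.congr_of_eventuallyEq h, ?_⟩
  rw [h.deriv.deriv_eq, h.eq_of_nhds]
  exact hu.2

theorem isHillSolutionAt_linear_combination (hs : IsOpen s) (hu : ∀ z ∈ s, IsHillSolutionAt g u z)
    (hv : ∀ z ∈ s, IsHillSolutionAt g v z) (a b : ℂ) :
    ∀ z ∈ s, IsHillSolutionAt g (fun z ↦ a * u z + b * v z) z := by
  intro z hz
  have hd : deriv (fun z ↦ a * u z + b * v z) =ᶠ[𝓝 z] fun z ↦ a * deriv u z + b * deriv v z := by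
    filter_upwards [hs.mem_nhds hz] with y hy
    exact (((hu y hy).1.hasDerivAt.const_mul a).add ((hv y hy).1.hasDerivAt.const_mul b)).deriv
  have hu2 := ((differentiableOn_of_isHillSolutionAt hu).deriv hs).differentiableAt (hs.mem_nhds hz)
  have hv2 := ((differentiableOn_of_isHillSolutionAt hv).deriv hs).differentiableAt (hs.mem_nhds hz)
  refine ⟨((hu z hz).1.const_mul a).add ((hv z hz).1.const_mul b), ?_⟩
  rw [hd.deriv_eq, ((hu2.hasDerivAt.const_mul a).fun_add (hv2.hasDerivAt.const_mul b)).deriv]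
  linear_combination a * (hu z hz).2 + b * (hv z hz).2

theorem hillWronskian_eq_of_isPreconnected (hs : IsOpen s) (hsc : IsPreconnected s)
    (hu : ∀ z ∈ s, IsHillSolutionAt g u z) (hv : ∀ z ∈ s, IsHillSolutionAt g v z)
    {x y : ℂ} (hx : x ∈ s) (hy : y ∈ s) : hillWronskian u v x = hillWronskian u v y := by
  have hderiv : ∀ z ∈ s, HasDerivAt (hillWronskian u v) 0 z := by
    intro z hz
    have hu2 :=
      ((differentiableOn_of_isHillSolutionAt hu).deriv hs).differentiableAt (hs.mem_nhds hz)
    have hv2 :=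
      ((differentiableOn_of_isHillSolutionAt hv).deriv hs).differentiableAt (hs.mem_nhds hz)
    convert! ((hu z hz).1.hasDerivAt.mul hv2.hasDerivAt).sub
      ((hv z hz).1.hasDerivAt.mul hu2.hasDerivAt) using 1
    linear_combination v z * (hu z hz).2 - u z * (hv z hz).2
  exact hs.is_const_of_deriv_eq_zero hsc
    (fun z hz ↦ (hderiv z hz).differentiableAt.differentiableWithinAt)
    (fun z hz ↦ (hderiv z hz).deriv) hx hy

theorem exists_isHillSolutionAt_eventuallyEq {x : ℂ} {r : ℝ}
    (hu : ∀ z ∈ ball x r, IsHillSolutionAt g u z) (hv : ∀ z ∈ ball x r, IsHillSolutionAt g v z)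
    (huv : ∀ z ∈ ball x r, hillWronskian u v z = 1) {y : ℂ} (hy : y ∈ ball x r)
    (hw : ∀ᶠ z in 𝓝 y, IsHillSolutionAt g w z) :
    ∃ f : ℂ → ℂ, (∀ z ∈ ball x r, IsHillSolutionAt g f z) ∧ f =ᶠ[𝓝 y] w := by
  obtain ⟨ε, hε, hball⟩ := Metric.mem_nhds_iff.1 (hw.and (isOpen_ball.eventually_mem hy))
  refine ⟨fun z ↦ hillWronskian w v y * u z + hillWronskian u w y * v z,
    isHillSolutionAt_linear_combination isOpen_ball hu hv _ _, ?_⟩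
  filter_upwards [ball_mem_nhds y hε] with z hz
  have hconn := (convex_ball y ε).isPreconnected
  have hw' : ∀ z ∈ ball y ε, IsHillSolutionAt g w z := fun z hz ↦ (hball hz).1
  rw [hillWronskian_eq_of_isPreconnected isOpen_ball hconn hw' (fun z hz ↦ hv z (hball hz).2)
      (mem_ball_self hε) hz,
    hillWronskian_eq_of_isPreconnected isOpen_ball hconn (fun z hz ↦ hu z (hball hz).2) hw'
      (mem_ball_self hε) hz]
  have := huv z (hball hz).2
  simp only [hillWronskian] at this ⊢
  linear_combination w z * this

theorem exists_isHillSolutionAt_of_simplyConnectedSpace (hs : IsOpen s) [SimplyConnectedSpace s]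
    (hg : DifferentiableOn ℂ g s) {x₀ : ℂ} (hx₀ : x₀ ∈ s) (α β : ℂ) :
    ∃ w : ℂ → ℂ, w x₀ = α ∧ deriv w x₀ = β ∧ ∀ z ∈ s, IsHillSolutionAt g w z := by
  have := hs.locallyPathConnectedSpace
  have hloc : ∀ x ∈ s, ∃ r > 0, ball x r ⊆ s ∧ ∀ α β : ℂ, ∃ f : ℂ → ℂ, f x = α ∧ deriv f x = β ∧
      ∀ z ∈ ball x r, IsHillSolutionAt g f z := by
    intro x hx
    obtain ⟨r, hr, hrs, h⟩ := exists_hill_solution_ball (hs.mem_nhds hx) hg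
    refine ⟨r, hr, hrs, fun α β ↦ ?_⟩
    obtain ⟨f, hα, hβ, hd, hf⟩ := h α β
    exact ⟨f, hα, hβ, fun z hz ↦ ⟨hd.differentiableAt (isOpen_ball.mem_nhds hz), hf z hz⟩⟩
  obtain ⟨r₀, hr₀, -, h₀⟩ := hloc x₀ hx₀
  obtain ⟨w₀, hα, hβ, hw₀⟩ := h₀ α β
  obtain ⟨w, hw, hws⟩ := exists_extension_of_locally_extendable (V := s) (IsHillSolutionAt g)
    (fun x hx ↦ by
      obtain ⟨r, hr, -, h⟩ := hloc x hx
      obtain ⟨u, hu0, hu1, hu⟩ := h 1 0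
      obtain ⟨v, hv0, hv1, hv⟩ := h 0 1
      have hconn := (convex_ball x r).isPreconnected
      have huv : ∀ z ∈ ball x r, hillWronskian u v z = 1 := fun z hz ↦ by
        rw [hillWronskian_eq_of_isPreconnected isOpen_ball hconn hu hv hz (mem_ball_self hr)]
        simp [hillWronskian, hu0, hv1, hu1]
      refine ⟨ball x r, isOpen_ball, mem_ball_self hr, fun y hy ↦ ⟨fun w hw ↦
        exists_isHillSolutionAt_eventuallyEq hu hv huv hy hw, fun F G hF hG hFG ↦ ?_⟩⟩
      exact ((differentiableOn_of_isHillSolutionAt hF).analyticOnNhd isOpen_ball)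
        |>.eqOn_of_preconnected_of_eventuallyEq
        ((differentiableOn_of_isHillSolutionAt hG).analyticOnNhd isOpen_ball) hconn hy hFG)
    hx₀ w₀ (by filter_upwards [ball_mem_nhds x₀ hr₀] with z hz using hw₀ z hz)
  rw [hs.nhdsWithin_eq hx₀] at hw
  refine ⟨w, hw.self_of_nhds.trans hα, (EventuallyEq.deriv_eq hw).trans hβ, fun z hz ↦ ?_⟩
  obtain ⟨f, hf, hwf⟩ := hws z hz
  rw [hs.nhdsWithin_eq hz] at hwf
  exact hf.self_of_nhds.congr hwf

end Hill

theorem wirtingerZ_log_norm_sq_add_norm_sq {u v : ℂ → ℂ} {z : ℂ} (hu : DifferentiableAt ℂ u z)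
    (hv : DifferentiableAt ℂ v z) (h : ‖u z‖ ^ 2 + ‖v z‖ ^ 2 ≠ 0) :
    wirtingerZ (fun w => (Real.log (‖u w‖ ^ 2 + ‖v w‖ ^ 2) : ℂ)) z =
      (deriv u z * starRingEnd ℂ (u z) + deriv v z * starRingEnd ℂ (v z)) /
        (‖u z‖ ^ 2 + ‖v z‖ ^ 2 : ℝ) := by
  have hu' := (hu.hasDerivAt.hasFDerivAt.restrictScalars ℝ).norm_sq
  have hv' := (hv.hasDerivAt.hasFDerivAt.restrictScalars ℝ).norm_sq
  have key := Complex.ofRealCLM.hasFDerivAt.comp z ((hu'.fun_add hv').log h)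
  have hfun : fderiv ℝ (fun w => (Real.log (‖u w‖ ^ 2 + ‖v w‖ ^ 2) : ℂ)) z = _ := key.fderiv
  have h' : ((‖u z‖ ^ 2 + ‖v z‖ ^ 2 : ℝ) : ℂ) ≠ 0 := by exact_mod_cast h
  rw [wirtingerZ, hfun]
  generalize ‖u z‖ ^ 2 + ‖v z‖ ^ 2 = N at h'
  rw [eq_div_iff h']
  simp only [Complex.inner, ContinuousLinearMap.comp_apply, smul_apply,
    add_apply, innerSL_apply_apply, Complex.ofRealCLM_apply]
  simp
  field_simp
  apply Complex.ext
  · simp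
  · simp
    ring

/-- On a nonempty simply connected domain `V ⊆ ℂ` with `ρ` holomorphic, for any
initial data `(z₀, u₀, q₀) ∈ V × ℝ × ℂ` there are holomorphic solutions `w₁, w₂`
of Hill's equation `w'' + (ρ/4) w = 0` with Wronskian `1/2` such that
`u = log(|w₁|² + |w₂|²)` satisfies `u(z₀) = u₀` and `∂_z u(z₀) = q₀`. -/
theorem exists_hill_solutions_with_initial_data
    (V : Set ℂ) (hV : IsOpen V) (hVconn : IsConnected V)
    (hVsc : SimplyConnectedSpace V)
    (ρ : ℂ → ℂ) (hρ : DifferentiableOn ℂ ρ V)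
    (z₀ : ℂ) (hz₀ : z₀ ∈ V) (u₀ : ℝ) (q₀ : ℂ) :
    ∃ w₁ w₂ : ℂ → ℂ,
      DifferentiableOn ℂ w₁ V ∧ DifferentiableOn ℂ w₂ V ∧
      (∀ z ∈ V, deriv (deriv w₁) z + ρ z / 4 * w₁ z = 0) ∧
      (∀ z ∈ V, deriv (deriv w₂) z + ρ z / 4 * w₂ z = 0) ∧
      (∀ z ∈ V, w₁ z * deriv w₂ z - w₂ z * deriv w₁ z = 1 / 2) ∧
      Real.log (‖w₁ z₀‖ ^ 2 + ‖w₂ z₀‖ ^ 2) = u₀ ∧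
      wirtingerZ (fun w => (Real.log (‖w₁ w‖ ^ 2 + ‖w₂ w‖ ^ 2) : ℂ)) z₀ = q₀ := by
  have := hVsc
  have hg : DifferentiableOn ℂ (fun z ↦ ρ z / 4) V := hρ.div_const 4
  obtain ⟨t, ht, htu⟩ : ∃ t : ℝ, 0 < t ∧ Real.log (t ^ 2) = u₀ :=
    ⟨Real.exp (u₀ / 2), Real.exp_pos _, by rw [Real.log_pow, Real.log_exp]; push_cast; ring⟩
  have htc : (t : ℂ) ≠ 0 := by exact_mod_cast ht.ne'
  obtain ⟨w₁, h₁, h₁', hw₁⟩ :=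
    exists_isHillSolutionAt_of_simplyConnectedSpace hV hg hz₀ t (q₀ * t)
  obtain ⟨w₂, h₂, h₂', hw₂⟩ :=
    exists_isHillSolutionAt_of_simplyConnectedSpace hV hg hz₀ 0 (1 / (2 * t))
  refine ⟨w₁, w₂, differentiableOn_of_isHillSolutionAt hw₁,
    differentiableOn_of_isHillSolutionAt hw₂,
    fun z hz ↦ (hw₁ z hz).2, fun z hz ↦ (hw₂ z hz).2, fun z hz ↦ ?_, ?_, ?_⟩
  · refine (hillWronskian_eq_of_isPreconnected hV hVconn.isPreconnected hw₁ hw₂ hz hz₀).trans ?_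
    rw [hillWronskian, h₁, h₂, h₂']
    field_simp
    ring
  · simpa [h₁, h₂] using htu
  · rw [wirtingerZ_log_norm_sq_add_norm_sq (hw₁ z₀ hz₀).1 (hw₂ z₀ hz₀).1
      (by simpa [h₁, h₂] using ht.ne'), h₁, h₂, h₁']
    simp
    field_simp
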